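/- arXiv:math/0209316 — 2 statements merged into one kernel-verified Lean document; each statement's English description precedes it below -/
import Mathlib

section
/- Let 𝒢 be any class of groups. The class of graphs Γ such that the Binary Cycle Test is valid for every gain graph (Γ, g, G) with gain group G ∈ 𝒢 is closed under taking minors. The same statement holds with the Circle Test in place of the Binary Cycle Test. -/
set_option maxHeartbeats 1000000
set_option synthInstance.maxHeartbeats 400000

attribute [local instance] Classical.propDecidable

noncomputable section

/-- A multigraph: loops and multiple edges are allowed.  Each edge `e` has a
reference orientation, from `src e` to `tgt e`. -/
structure MGraph : Type 1 where
  V : Type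
  E : Type
  src : E → V
  tgt : E → V

/-- A class of groups (a property of groups). -/
abbrev GroupClass : Type 1 := (G : Type) → Group G → Prop

/-- A subgroup-closed class of groups. -/
def SubgroupClosed (𝒢 : GroupClass) : Prop :=
  ∀ (G : Type) [instG : Group G], 𝒢 G instG → ∀ H : Subgroup G, 𝒢 H inferInstance

/-- The number of occurrences of `a` in the list `l`. -/
def countIn {α : Type} (l : List α) (a : α) : ℕ :=
  (l.map fun x => if x = a then 1 else 0).sum

namespace MGraph

/-- A step of a walk: an edge together with a direction of traversal
(`true` = from `src` to `tgt`). -/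
abbrev Step (Γ : MGraph) : Type := Γ.E × Bool

def stepStart (Γ : MGraph) (s : Γ.Step) : Γ.V := if s.2 then Γ.src s.1 else Γ.tgt s.1

def stepEnd (Γ : MGraph) (s : Γ.Step) : Γ.V := if s.2 then Γ.tgt s.1 else Γ.src s.1

/-- `IsWalkFrom Γ a b l`: the list of steps `l` is a walk from `a` to `b`. -/
inductive IsWalkFrom (Γ : MGraph) : Γ.V → Γ.V → List Γ.Step → Prop
  | nil (v : Γ.V) : IsWalkFrom Γ v v []
  | cons {a b : Γ.V} {s : Γ.Step} {l : List Γ.Step} :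
      Γ.stepStart s = a → IsWalkFrom Γ (Γ.stepEnd s) b l → IsWalkFrom Γ a b (s :: l)

section Walks

variable (Γ : MGraph)

/-- The list of edges underlying a walk. -/
def walkEdges (l : List Γ.Step) : List Γ.E := l.map Prod.fst

/-- The list of vertices visited by a walk starting at `a`. -/
def walkVerts (a : Γ.V) (l : List Γ.Step) : List Γ.V := a :: l.map Γ.stepEnd

/-- A closed walk (given as its list of steps) is simple if it is nontrivial and
repeats no edge and no vertex (except that initial vertex = final vertex). -/
def IsSimpleClosed (l : List Γ.Step) : Prop :=
  l ≠ [] ∧ (Γ.walkEdges l).Nodup ∧ (l.map Γ.stepStart).Nodup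

section Gain

variable {G : Type} [Group G]

/-- The gain of a single step, for a gain function `g`. -/
def stepGain (g : Γ.E → G) (s : Γ.Step) : G := if s.2 then g s.1 else (g s.1)⁻¹

/-- The gain of a walk: the product of the gains of its steps, in order. -/
def walkGain (g : Γ.E → G) (l : List Γ.Step) : G := (l.map (Γ.stepGain g)).prod

/-- A gain graph is balanced if every simple closed walk has gain `1`. -/
def IsBalanced (g : Γ.E → G) : Prop :=
  ∀ (v : Γ.V) (l : List Γ.Step),
    Γ.IsWalkFrom v v l → Γ.IsSimpleClosed l → Γ.walkGain g l = 1

end Gain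

/-- The mod-2 boundary map from edge chains to vertex chains. -/
def boundary : (Γ.E →₀ ZMod 2) →ₗ[ZMod 2] (Γ.V →₀ ZMod 2) :=
  Finsupp.lsum (ZMod 2) fun e => Finsupp.lsingle (Γ.src e) + Finsupp.lsingle (Γ.tgt e)

/-- The binary cycle space `Z₁(Γ; ℤ₂)`: mod-2 edge chains with even degree at
every vertex. -/
def cycleSpace : Submodule (ZMod 2) (Γ.E →₀ ZMod 2) := LinearMap.ker Γ.boundary

/-- `B` is a basis of the binary cycle space of `Γ`. -/
def IsCycleBasis (B : Set (Γ.E →₀ ZMod 2)) : Prop :=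
  (∀ c ∈ B, c ∈ Γ.cycleSpace) ∧
  LinearIndependent (ZMod 2) (fun c : B => c.1) ∧
  ∀ c ∈ Γ.cycleSpace, c ∈ Submodule.span (ZMod 2) B

/-- The closed walk `l` is a cyclic orientation of the binary cycle `c`:
it is closed and its edge multiplicities reduced mod 2 give `c`. -/
def IsCyclicOrientation (c : Γ.E →₀ ZMod 2) (l : List Γ.Step) : Prop :=
  (∃ v, Γ.IsWalkFrom v v l) ∧ ∀ e : Γ.E, c e = (countIn (Γ.walkEdges l) e : ZMod 2)

/-- The binary cycle `c` is a circle: it is the (indicator of the) edge set of a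
simple closed walk. -/
def IsCircleCycle (c : Γ.E →₀ ZMod 2) : Prop :=
  ∃ l, Γ.IsSimpleClosed l ∧ Γ.IsCyclicOrientation c l

section Tests

variable {G : Type} [Group G]

/-- `B` passes the Binary Cycle Test: it has a cyclic orientation all of whose
closed walks have gain `1`. -/
def PassesBCT (g : Γ.E → G) (B : Set (Γ.E →₀ ZMod 2)) : Prop :=
  ∀ c ∈ B, ∃ l, Γ.IsCyclicOrientation c l ∧ Γ.walkGain g l = 1

/-- The Binary Cycle Test is valid for the gain graph `(Γ, g, G)`. -/
def BCTValid (g : Γ.E → G) : Prop :=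
  (∃ B, Γ.IsCycleBasis B ∧ Γ.PassesBCT g B) → Γ.IsBalanced g

/-- `c` is a circle whose natural traversal as a simple closed walk has gain 1. -/
def IsBalancedCircleCycle (g : Γ.E → G) (c : Γ.E →₀ ZMod 2) : Prop :=
  ∃ l, Γ.IsSimpleClosed l ∧ Γ.IsCyclicOrientation c l ∧ Γ.walkGain g l = 1

/-- The Circle Test is valid for the gain graph `(Γ, g, G)`: if some basis of the
binary cycle space consists of balanced circles, then the gain graph is balanced. -/
def CircleTestValid (g : Γ.E → G) : Prop :=
  (∃ B, Γ.IsCycleBasis B ∧ ∀ c ∈ B, Γ.IsBalancedCircleCycle g c) → Γ.IsBalanced g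

end Tests

/-- The Binary Cycle Test is valid for `Γ` with respect to the class `𝒢`. -/
def BCTValidFor (𝒢 : GroupClass) : Prop :=
  ∀ (G : Type) [instG : Group G], 𝒢 G instG → ∀ g : Γ.E → G, Γ.BCTValid g

/-- The Circle Test is valid for `Γ` with respect to the class `𝒢`
(`Γ` is a "good" graph for `𝒢`). -/
def CircleTestValidFor (𝒢 : GroupClass) : Prop :=
  ∀ (G : Type) [instG : Group G], 𝒢 G instG → ∀ g : Γ.E → G, Γ.CircleTestValid g

/-- Deletion of a set of edges. -/
def deleteEdges (S : Set Γ.E) : MGraph where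
  V := Γ.V
  E := {e : Γ.E // e ∉ S}
  src e := Γ.src e.1
  tgt e := Γ.tgt e.1

/-- The relation identifying the two endpoints of each edge of `S`. -/
def contractRel (S : Set Γ.E) : Γ.V → Γ.V → Prop :=
  fun x y => ∃ e ∈ S, Γ.src e = x ∧ Γ.tgt e = y

/-- Contraction `Γ/S`: vertices in the same component of `(V, S)` are identified
and the edges of `S` are deleted. -/
def contract (S : Set Γ.E) : MGraph where
  V := Quot (Γ.contractRel S)
  E := {e : Γ.E // e ∉ S}
  src e := Quot.mk _ (Γ.src e.1)
  tgt e := Quot.mk _ (Γ.tgt e.1)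

/-- The subgraph with vertex set `U` and edge set the edges of `T` having both
endpoints in `U`. -/
def subgraph (U : Set Γ.V) (T : Set Γ.E) : MGraph where
  V := U
  E := {e : Γ.E // e ∈ T ∧ Γ.src e ∈ U ∧ Γ.tgt e ∈ U}
  src e := ⟨Γ.src e.1, e.2.2.1⟩
  tgt e := ⟨Γ.tgt e.1, e.2.2.2⟩

/-- The set of vertices incident with an edge of `D`. -/
def edgeVerts (D : Set Γ.E) : Set Γ.V := {x | ∃ e ∈ D, Γ.src e = x ∨ Γ.tgt e = x}

/-- The subgraph spanned by an edge set `D`. -/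
def edgeSubgraph (D : Set Γ.E) : MGraph := Γ.subgraph (Γ.edgeVerts D) D

/-- Adjacency of vertices. -/
def Adj (x y : Γ.V) : Prop :=
  ∃ e : Γ.E, (Γ.src e = x ∧ Γ.tgt e = y) ∨ (Γ.src e = y ∧ Γ.tgt e = x)

/-- A graph with no loops. -/
def Loopless : Prop := ∀ e : Γ.E, Γ.src e ≠ Γ.tgt e

/-- A finite graph. -/
def IsFiniteGraph : Prop := Finite Γ.V ∧ Finite Γ.E

/-- A graph is inseparable if any two distinct edges lie in a common circle. -/
def Inseparable : Prop :=
  ∀ e f : Γ.E, e ≠ f →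
    ∃ (v : Γ.V) (l : List Γ.Step), Γ.IsWalkFrom v v l ∧ Γ.IsSimpleClosed l ∧
      e ∈ Γ.walkEdges l ∧ f ∈ Γ.walkEdges l

/-- `D` is (the edge set of) a block of `Γ`: a maximal inseparable subgraph. -/
def IsBlock (D : Set Γ.E) : Prop :=
  (Γ.edgeSubgraph D).Inseparable ∧
  ∀ D', D ⊆ D' → (Γ.edgeSubgraph D').Inseparable → D' = D

/-- The edge set `D` is a circle of `Γ`. -/
def IsCircleSet (D : Set Γ.E) : Prop :=
  ∃ (v : Γ.V) (l : List Γ.Step), Γ.IsWalkFrom v v l ∧ Γ.IsSimpleClosed l ∧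
    D = {e | e ∈ Γ.walkEdges l}

/-- The edge set `D` is a balanced circle for the gain function `g`. -/
def IsBalancedCircleSet {G : Type} [Group G] (g : Γ.E → G) (D : Set Γ.E) : Prop :=
  Γ.IsCircleSet D ∧
  ∀ (v : Γ.V) (l : List Γ.Step), Γ.IsWalkFrom v v l → Γ.IsSimpleClosed l →
    D = {e | e ∈ Γ.walkEdges l} → Γ.walkGain g l = 1

end Walks

/-- An isomorphism of multigraphs (preserving endpoints as unordered pairs). -/
structure Iso (Γ Δ : MGraph) where
  vEquiv : Γ.V ≃ Δ.V
  eEquiv : Γ.E ≃ Δ.E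
  ends_eq : ∀ e : Γ.E,
    s(Δ.src (eEquiv e), Δ.tgt (eEquiv e)) = s(vEquiv (Γ.src e), vEquiv (Γ.tgt e))

/-- `Δ` is a minor of `Γ`: `Δ` is isomorphic to a subgraph of a contraction of `Γ`. -/
def IsMinor (Δ Γ : MGraph) : Prop :=
  ∃ (S : Set Γ.E) (U : Set (Γ.contract S).V) (T : Set (Γ.contract S).E),
    Nonempty (Iso Δ ((Γ.contract S).subgraph U T))

/-- Subdivision of the edge `e₀` into a path of length two. -/
def subdivide (Γ : MGraph) (e₀ : Γ.E) : MGraph where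
  V := Γ.V ⊕ Unit
  E := Γ.E ⊕ Unit
  src := fun e => match e with
    | .inl e => Sum.inl (Γ.src e)
    | .inr _ => Sum.inr ()
  tgt := fun e => match e with
    | .inl e => if e = e₀ then Sum.inr () else Sum.inl (Γ.tgt e)
    | .inr _ => Sum.inl (Γ.tgt e₀)

/-- One subdivision step (up to isomorphism). -/
def SubdivisionStep (A B : MGraph) : Prop :=
  Nonempty (Iso B A) ∨ ∃ e₀ : A.E, Nonempty (Iso B (A.subdivide e₀))

/-- `Δ` is (isomorphic to) a graph obtained from `Γ₀` by subdividing edges. -/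
def IsSubdivisionOf (Δ Γ₀ : MGraph) : Prop :=
  ∃ Δ', Relation.ReflTransGen SubdivisionStep Γ₀ Δ' ∧ Nonempty (Iso Δ Δ')

/-- Two graphs are homeomorphic if both are obtained by subdividing edges of a
common graph. -/
def Homeomorphic (Γ₁ Γ₂ : MGraph) : Prop :=
  ∃ Γ₀, IsSubdivisionOf Γ₁ Γ₀ ∧ IsSubdivisionOf Γ₂ Γ₀

section Ops

variable (Γ : MGraph)

/-- Interchange `u` and `v`. -/
def twistVert (u v x : Γ.V) : Γ.V := if x = u then v else if x = v then u else x

/-- The result of twisting the edge set `A` across `{u, v}`: every endpoint of an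
edge of `A` at `u` is reconnected to `v` and vice versa. -/
def twist (u v : Γ.V) (A : Set Γ.E) : MGraph where
  V := Γ.V
  E := Γ.E
  src e := if e ∈ A then Γ.twistVert u v (Γ.src e) else Γ.src e
  tgt e := if e ∈ A then Γ.twistVert u v (Γ.tgt e) else Γ.tgt e

/-- `x` and `y` are joined by a walk all of whose vertices avoid `u` and `v`. -/
def AvoidConn (u v x y : Γ.V) : Prop :=
  ∃ l, Γ.IsWalkFrom x y l ∧ ∀ z ∈ Γ.walkVerts x l, z ≠ u ∧ z ≠ v

/-- `P` is the vertex set of a union of some, but not all, of the components of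
`Γ ∖ {u, v}` (the data of a Whitney twist across the 2-separation `{u,v}`). -/
def IsWhitneyTwistData (u v : Γ.V) (P : Set Γ.V) : Prop :=
  (∀ x ∈ P, x ≠ u ∧ x ≠ v) ∧
  (∀ x ∈ P, ∀ y, Γ.AvoidConn u v x y → y ∈ P) ∧
  P.Nonempty ∧ (∃ y : Γ.V, y ∉ P ∧ y ≠ u ∧ y ≠ v)

/-- `(v, w, F)` is valid data for extruding the vertex `v`: `w` is a neighbor of
`v` and `F` is a nonempty set of edges joining `v` and `w`. -/
def IsExtrusionData (v w : Γ.V) (F : Set Γ.E) : Prop :=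
  v ≠ w ∧ F.Nonempty ∧
  ∀ e ∈ F, (Γ.src e = v ∧ Γ.tgt e = w) ∨ (Γ.src e = w ∧ Γ.tgt e = v)

/-- Extrusion of a new vertex `v′` from `v`: the edges of `F` are reattached to
join `v′` to `w`, and a new edge joins `v` to `v′`. -/
def extrude (v w : Γ.V) (F : Set Γ.E) : MGraph where
  V := Γ.V ⊕ Unit
  E := Γ.E ⊕ Unit
  src := fun e => match e with
    | .inl e => if e ∈ F ∧ Γ.src e = v then Sum.inr () else Sum.inl (Γ.src e)
    | .inr _ => Sum.inl v
  tgt := fun e => match e with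
    | .inl e => if e ∈ F ∧ Γ.tgt e = v then Sum.inr () else Sum.inl (Γ.tgt e)
    | .inr _ => Sum.inr ()

end Ops

/-- `Δ` is obtained from `Γ` by extruding a vertex (up to isomorphism). -/
def IsExtrusionOf (Δ Γ : MGraph) : Prop :=
  ∃ (v w : Γ.V) (F : Set Γ.E),
    Γ.IsExtrusionData v w F ∧ Nonempty (Iso Δ (Γ.extrude v w F))

/-- `Γ` is extrusion-irreducible: it is not obtainable by extrusion from a
smaller graph. -/
def ExtrusionIrreducible (Γ : MGraph) : Prop := ¬ ∃ Δ : MGraph, IsExtrusionOf Γ Δ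

/-- `Δ` is obtained from `Γ₀` by a (possibly empty) sequence of extrusions,
up to isomorphism. -/
def ObtainedByExtrusions (Δ Γ₀ : MGraph) : Prop :=
  ∃ Δ', Relation.ReflTransGen (fun A B => IsExtrusionOf B A) Γ₀ Δ' ∧ Nonempty (Iso Δ Δ')

section Bridges

variable (Γ : MGraph)

/-- The walk `l` is internally disjoint from `{u, v}`. -/
def IntDisjWalk (u v : Γ.V) (l : List Γ.Step) : Prop :=
  ∀ z ∈ (l.map Γ.stepEnd).dropLast, z ≠ u ∧ z ≠ v

/-- Two edges lie in a common walk internally disjoint from `{u, v}`. -/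
def InBridgeRel (u v : Γ.V) (e f : Γ.E) : Prop :=
  ∃ (a b : Γ.V) (l : List Γ.Step), Γ.IsWalkFrom a b l ∧ Γ.IntDisjWalk u v l ∧
    e ∈ Γ.walkEdges l ∧ f ∈ Γ.walkEdges l

/-- `D` is (the edge set of) a bridge of `{u, v}`: a maximal set of edges any two
of which lie in a common walk internally disjoint from `{u, v}`. -/
def IsBridge (u v : Γ.V) (D : Set Γ.E) : Prop :=
  D.Nonempty ∧ (∀ e ∈ D, ∀ f ∈ D, Γ.InBridgeRel u v e f) ∧
  ∀ D', D ⊆ D' → (∀ e ∈ D', ∀ f ∈ D', Γ.InBridgeRel u v e f) → D' = D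

/-- The set `A` of vertices is connected using only edges of `D`, within `A`. -/
def SetConnWith (D : Set Γ.E) (A : Set Γ.V) : Prop :=
  ∀ x ∈ A, ∀ y ∈ A, ∃ l, Γ.IsWalkFrom x y l ∧ (∀ s ∈ l, s.1 ∈ D) ∧
    ∀ z ∈ Γ.walkVerts x l, z ∈ A

/-- The subgraph with edge set `D` has `2P_{2uv}` (a four-circle with `u`, `v` as
opposite vertices) as a minor rooted at `u` and `v`, expressed by branch sets. -/
def HasRooted2P2Minor (u v : Γ.V) (D : Set Γ.E) : Prop :=
  ∃ β : Fin 4 → Set Γ.V,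
    (∀ i j, i ≠ j → Disjoint (β i) (β j)) ∧
    (∀ i, (β i).Nonempty ∧ Γ.SetConnWith D (β i)) ∧
    u ∈ β 0 ∧ v ∈ β 2 ∧
    ∀ i : Fin 4, ∃ e ∈ D,
      (Γ.src e ∈ β i ∧ Γ.tgt e ∈ β (i + 1)) ∨ (Γ.src e ∈ β (i + 1) ∧ Γ.tgt e ∈ β i)

/-- Removing the vertex `w` disconnects the subgraph with edge set `D`. -/
def SeparatesBridge (D : Set Γ.E) (w : Γ.V) : Prop :=
  ∃ x ∈ Γ.edgeVerts D, ∃ y ∈ Γ.edgeVerts D, x ≠ w ∧ y ≠ w ∧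
    ¬ ∃ l, Γ.IsWalkFrom x y l ∧ (∀ s ∈ l, s.1 ∈ D) ∧ ∀ z ∈ Γ.walkVerts x l, z ≠ w

end Bridges

/-! ### Particular graphs -/

/-- `K₁°`: one vertex with one loop. -/
@[reducible] def loopGraph : MGraph where
  V := Unit
  E := Unit
  src _ := ()
  tgt _ := ()

/-- `mK₂`: two vertices joined by `m` parallel edges. -/
@[reducible] def banana (m : ℕ) : MGraph where
  V := Bool
  E := Fin m
  src _ := false
  tgt _ := true

/-- `C_l(m₁, …, m_l)`: a circle of length `l` whose `i`-th edge is replaced by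
`m i` parallel copies. -/
@[reducible] def multiCircle (l : ℕ) (m : Fin l → ℕ) : MGraph where
  V := Fin l
  E := Σ i : Fin l, Fin (m i)
  src e := e.1
  tgt e := ⟨(e.1.1 + 1) % l, Nat.mod_lt _ e.1.pos⟩

/-- `2C_n`: the circle of length `n` with every edge doubled. -/
@[reducible] def twoCircle (n : ℕ) : MGraph := multiCircle n fun _ => 2

/-- `K₄(m, m′)`: `K₄` with two opposite (nonadjacent) edges replaced by `m` and
`m′` parallel copies respectively. -/
@[reducible] def K4m (m m' : ℕ) : MGraph where
  V := Fin 4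
  E := (Fin m ⊕ Fin m') ⊕ Fin 4
  src := fun e => match e with
    | .inl (.inl _) => 0
    | .inl (.inr _) => 2
    | .inr j => ![0, 0, 1, 1] j
  tgt := fun e => match e with
    | .inl (.inl _) => 1
    | .inl (.inr _) => 3
    | .inr j => ![2, 3, 2, 3] j

/-- `K₄''`: `K₄` with two adjacent edges doubled. -/
@[reducible] def K4dd : MGraph where
  V := Fin 4
  E := Fin 8
  src := ![0, 0, 0, 0, 0, 1, 1, 2]
  tgt := ![1, 1, 2, 2, 3, 2, 3, 3]

/-- The `n`-spoke wheel `W_n`: rim vertices `Fin n` and a hub; `inl i` is the rim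
edge from `v_i` to `v_{i+1}` and `inr i` is the spoke from the hub to `v_i`. -/
@[reducible] def wheel (n : ℕ) : MGraph where
  V := Fin n ⊕ Unit
  E := Fin n ⊕ Fin n
  src := fun e => match e with
    | .inl i => Sum.inl i
    | .inr _ => Sum.inr ()
  tgt := fun e => match e with
    | .inl i => Sum.inl ⟨(i.1 + 1) % n, Nat.mod_lt _ i.pos⟩
    | .inr i => Sum.inl i

instance (n : ℕ) : Finite ((wheel n).E) := inferInstanceAs (Finite (Fin n ⊕ Fin n))

/-- The indicator of an edge set, as a binary chain. -/
def indicatorCycle (Γ : MGraph) [Finite Γ.E] (D : Set Γ.E) : Γ.E →₀ ZMod 2 :=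
  Finsupp.equivFunOnFinite.symm fun e => if e ∈ D then 1 else 0

/-- The edge set of the Hamiltonian circle of `W_n` omitting the rim edge `r`:
all rim edges except `r`, together with the two spokes at the ends of `r`. -/
def wheelHamSet (n : ℕ) (r : Fin n) : Set (wheel n).E :=
  {e | Sum.elim (fun j : Fin n => j ≠ r)
      (fun j : Fin n => j = r ∨ j = ⟨(r.1 + 1) % n, Nat.mod_lt _ r.pos⟩) e}

/-- The set of (indicators of) the `n` Hamiltonian circles of the wheel `W_n`. -/
def wheelHamBasis (n : ℕ) : Set ((wheel n).E →₀ ZMod 2) :=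
  {c | ∃ r : Fin n, c = indicatorCycle (wheel n) (wheelHamSet n r)}

/-- A theta graph: a graph homeomorphic to a triple link. -/
def IsThetaGraph (Δ : MGraph) : Prop := Homeomorphic Δ (banana 3)

end MGraph

end

namespace MGraph

section MinorProof

variable {Γ Δ : MGraph}

theorem IsWalkFrom.append {a b c : Γ.V} {l m : List Γ.Step} (h : Γ.IsWalkFrom a b l)
    (h' : Γ.IsWalkFrom b c m) : Γ.IsWalkFrom a c (l ++ m) := by
  induction h with
  | nil v => exact h'
  | cons hs _ ih => exact .cons hs (ih h')

theorem IsWalkFrom.single (s : Γ.Step) :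
    Γ.IsWalkFrom (Γ.stepStart s) (Γ.stepEnd s) [s] := .cons rfl (.nil _)

theorem stepStart_not (s : Γ.Step) : Γ.stepStart (s.1, !s.2) = Γ.stepEnd s := by
  rcases s with ⟨e, _ | _⟩ <;> rfl

theorem stepEnd_not (s : Γ.Step) : Γ.stepEnd (s.1, !s.2) = Γ.stepStart s := by
  rcases s with ⟨e, _ | _⟩ <;> rfl

/-- Reachability using edges of `X`. -/
def Reach (Γ : MGraph) (X : Set Γ.E) (x y : Γ.V) : Prop :=
  ∃ l, Γ.IsWalkFrom x y l ∧ ∀ s ∈ l, s.1 ∈ X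

theorem Reach.refl (X : Set Γ.E) (x : Γ.V) : Γ.Reach X x x := ⟨[], .nil _, by simp⟩

theorem Reach.trans {X : Set Γ.E} {x y z : Γ.V} (h : Γ.Reach X x y) (h' : Γ.Reach X y z) :
    Γ.Reach X x z := by
  obtain ⟨l, hl, hX⟩ := h
  obtain ⟨m, hm, hX'⟩ := h'
  refine ⟨l ++ m, hl.append hm, ?_⟩
  intro s hs
  rcases List.mem_append.1 hs with h | h
  · exact hX s h
  · exact hX' s h

theorem Reach.step {X : Set Γ.E} (s : Γ.Step) (hs : s.1 ∈ X) :
    Γ.Reach X (Γ.stepStart s) (Γ.stepEnd s) := ⟨[s], .single s, by simpa using hs⟩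

theorem Reach.symm {X : Set Γ.E} {x y : Γ.V} (h : Γ.Reach X x y) : Γ.Reach X y x := by
  obtain ⟨l, hl, hX⟩ := h
  induction hl with
  | nil v => exact Reach.refl _ _
  | @cons a b s l hs _ ih =>
    subst hs
    refine (ih fun t ht => hX t (by simp [ht])).trans ?_
    have := Reach.step (X := X) (s.1, !s.2) (hX s (by simp))
    rwa [stepStart_not, stepEnd_not] at this

/-- Simple paths inside `X`. -/
structure IsPathIn (Γ : MGraph) (X : Set Γ.E) (x y : Γ.V) (p : List Γ.Step) : Prop where
  walk : Γ.IsWalkFrom x y p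
  mem : ∀ s ∈ p, s.1 ∈ X
  verts : (p.map Γ.stepStart ++ [y]).Nodup
  edges : (p.map Prod.fst).Nodup

theorem IsWalkFrom.suffix {a b : Γ.V} {p : List Γ.Step} (h : Γ.IsWalkFrom a b p) (v : Γ.V)
    (hv : v ∈ p.map Γ.stepStart ++ [b]) : ∃ p₁ p₂, p = p₁ ++ p₂ ∧ Γ.IsWalkFrom v b p₂ := by
  induction h with
  | nil w =>
    simp at hv
    subst hv
    exact ⟨[], [], rfl, .nil _⟩
  | @cons a b s l hs hw ih =>
    rw [List.map_cons, List.cons_append, List.mem_cons] at hv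
    rcases hv with hv | hv
    · subst hv
      exact ⟨[], s :: l, rfl, .cons rfl hw⟩
    · obtain ⟨p₁, p₂, rfl, h⟩ := ih hv
      exact ⟨s :: p₁, p₂, rfl, h⟩

theorem IsWalkFrom.start_mem {a b : Γ.V} {p : List Γ.Step} (h : Γ.IsWalkFrom a b p) :
    a ∈ p.map Γ.stepStart ++ [b] := by
  cases h with
  | nil => simp
  | cons hs _ => simp [hs]

theorem IsWalkFrom.verts_mem {a b : Γ.V} {p : List Γ.Step} (h : Γ.IsWalkFrom a b p)
    (s : Γ.Step) (hs : s ∈ p) :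
    Γ.stepStart s ∈ p.map Γ.stepStart ++ [b] ∧ Γ.stepEnd s ∈ p.map Γ.stepStart ++ [b] := by
  induction h with
  | nil w => simp at hs
  | @cons a b t l ht hw ih =>
    rw [List.map_cons, List.cons_append, List.mem_cons, List.mem_cons]
    rcases List.mem_cons.1 hs with rfl | hs
    · exact ⟨Or.inl rfl, Or.inr hw.start_mem⟩
    · exact ⟨Or.inr (ih hs).1, Or.inr (ih hs).2⟩

theorem step_eq_or (s t : Γ.Step) (h : s.1 = t.1) :
    Γ.stepStart s = Γ.stepStart t ∨ Γ.stepStart s = Γ.stepEnd t := by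
  rcases s with ⟨e, b⟩
  rcases t with ⟨f, c⟩
  simp only at h
  subst h
  cases b <;> cases c <;> simp [stepStart, stepEnd]

theorem Reach.exists_path {X : Set Γ.E} {x y : Γ.V} (h : Γ.Reach X x y) :
    ∃ p, Γ.IsPathIn X x y p := by
  obtain ⟨l, hl, hX⟩ := h
  induction hl with
  | nil v => exact ⟨[], .nil _, by simp, by simp, by simp⟩
  | @cons a b s l hs hw ih =>
    obtain ⟨p, hp⟩ := ih fun t ht => hX t (by simp [ht])
    subst hs
    by_cases hm : Γ.stepStart s ∈ p.map Γ.stepStart ++ [b]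
    · obtain ⟨p₁, p₂, rfl, h⟩ := hp.walk.suffix _ hm
      refine ⟨p₂, h, fun t ht => hp.mem t (by simp [ht]), ?_, ?_⟩
      · have := hp.verts
        rw [List.map_append, List.append_assoc] at this
        exact (List.nodup_append.1 this).2.1
      · have := hp.edges
        rw [List.map_append] at this
        exact (List.nodup_append.1 this).2.1
    · refine ⟨s :: p, .cons rfl hp.walk, ?_, ?_, ?_⟩
      · intro t ht
        rcases List.mem_cons.1 ht with rfl | ht
        · exact hX _ (by simp)
        · exact hp.mem t ht
      · rw [List.map_cons, List.cons_append]
        exact List.nodup_cons.2 ⟨hm, hp.verts⟩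
      · rw [List.map_cons]
        refine List.nodup_cons.2 ⟨?_, hp.edges⟩
        intro h
        obtain ⟨t, ht, hts⟩ := List.mem_map.1 h
        have := hp.walk.verts_mem t ht
        rcases step_eq_or s t hts.symm with h | h
        · exact hm (h ▸ this.1)
        · exact hm (h ▸ this.2)

/-- The binary chain of a list of steps. -/
noncomputable def chain (Γ : MGraph) (l : List Γ.Step) : Γ.E →₀ ZMod 2 :=
  (l.map fun s => Finsupp.single s.1 (1 : ZMod 2)).sum

theorem chain_nil : Γ.chain [] = 0 := rfl

theorem chain_cons (s : Γ.Step) (l : List Γ.Step) :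
    Γ.chain (s :: l) = Finsupp.single s.1 1 + Γ.chain l := by simp [chain]

theorem chain_append (l m : List Γ.Step) : Γ.chain (l ++ m) = Γ.chain l + Γ.chain m := by
  simp [chain]

theorem chain_apply (l : List Γ.Step) (e : Γ.E) :
    Γ.chain l e = (countIn (Γ.walkEdges l) e : ZMod 2) := by
  induction l with
  | nil => simp [chain, countIn, walkEdges]
  | cons s l ih =>
    rw [chain_cons, Finsupp.add_apply, ih]
    by_cases h : s.1 = e <;> simp [countIn, walkEdges, Finsupp.single_apply, h]

theorem chain_apply_zero (l : List Γ.Step) (e : Γ.E) (h : ∀ s ∈ l, s.1 ≠ e) :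
    Γ.chain l e = 0 := by
  induction l with
  | nil => simp [chain]
  | cons s l ih =>
    rw [chain_cons, Finsupp.add_apply, ih fun t ht => h t (by simp [ht]),
      Finsupp.single_eq_of_ne' (h s (by simp)), add_zero]

theorem chain_mem_supported (l : List Γ.Step) (X : Set Γ.E) (h : ∀ s ∈ l, s.1 ∈ X) :
    Γ.chain l ∈ Finsupp.supported (ZMod 2) (ZMod 2) X := by
  rw [Finsupp.mem_supported']
  intro e he
  exact chain_apply_zero l e fun s hs hse => he (hse ▸ h s hs)

theorem boundary_single (e : Γ.E) :
    Γ.boundary (Finsupp.single e 1) =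
      Finsupp.single (Γ.src e) 1 + Finsupp.single (Γ.tgt e) 1 := by
  simp [boundary]

theorem add_self_zero {α : Type} (c : α →₀ ZMod 2) : c + c = 0 := by
  ext a
  exact CharTwo.add_self_eq_zero _

theorem boundary_step (s : Γ.Step) :
    Γ.boundary (Finsupp.single s.1 1) =
      Finsupp.single (Γ.stepStart s) 1 + Finsupp.single (Γ.stepEnd s) 1 := by
  rw [boundary_single]
  rcases s with ⟨e, _ | _⟩
  · exact add_comm _ _
  · rfl

theorem boundary_chain {a b : Γ.V} {l : List Γ.Step} (h : Γ.IsWalkFrom a b l) :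
    Γ.boundary (Γ.chain l) = Finsupp.single a 1 + Finsupp.single b 1 := by
  induction h with
  | nil v => rw [chain_nil, map_zero, add_self_zero]
  | @cons a b s l hs hw ih =>
    subst hs
    rw [chain_cons, map_add, ih, boundary_step, add_assoc, ← add_assoc _ _ (Finsupp.single b 1),
      add_self_zero, zero_add]

theorem chain_mem {a : Γ.V} {l : List Γ.Step} (h : Γ.IsWalkFrom a a l) :
    Γ.chain l ∈ Γ.cycleSpace := by
  rw [cycleSpace, LinearMap.mem_ker, boundary_chain h, add_self_zero]

theorem orientation_chain {a : Γ.V} {l : List Γ.Step} (h : Γ.IsWalkFrom a a l) :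
    Γ.IsCyclicOrientation (Γ.chain l) l := ⟨⟨a, h⟩, chain_apply l⟩

theorem eq_chain {c : Γ.E →₀ ZMod 2} {l : List Γ.Step} (h : Γ.IsCyclicOrientation c l) :
    c = Γ.chain l := by
  ext e
  rw [h.2 e, chain_apply]

/-- A binary cycle through `e` contains a circle through `e`. -/
theorem exists_circle {c : Γ.E →₀ ZMod 2} (hc : c ∈ Γ.cycleSpace) (e : Γ.E) (he : c e ≠ 0) :
    ∃ p, Γ.IsPathIn {f | c f ≠ 0 ∧ f ≠ e} (Γ.tgt e) (Γ.src e) p := by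
  set X : Set Γ.E := {f | c f ≠ 0 ∧ f ≠ e} with hX
  apply Reach.exists_path
  by_contra hR
  let R : Set Γ.V := {v | Γ.Reach X (Γ.tgt e) v}
  let χ : (Γ.V →₀ ZMod 2) →ₗ[ZMod 2] ZMod 2 :=
    Finsupp.lsum (ZMod 2) fun v => if v ∈ R then LinearMap.id else 0
  have hR' : Γ.src e ∉ R := hR
  have hRt : Γ.tgt e ∈ R := Reach.refl _ _
  have hχ : ∀ v, χ (Finsupp.single v 1) = if v ∈ R then 1 else 0 := by
    intro v
    by_cases h : v ∈ R <;> simp [χ, h]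
  have h0 : χ (Γ.boundary c) = 0 := by
    rw [LinearMap.mem_ker.1 hc, map_zero]
  have h1 : c = c.sum fun f a => a • Finsupp.single f (1 : ZMod 2) := by
    conv_lhs => rw [← Finsupp.sum_single c]
    simp
  rw [h1, Finsupp.sum, map_sum, map_sum, Finset.sum_eq_single e] at h0
  · rw [map_smul, map_smul, boundary_single, map_add, hχ, hχ, if_neg hR',
      if_pos hRt, zero_add, smul_eq_mul, mul_one] at h0
    exact he h0
  · intro f hf hfe
    rw [map_smul, map_smul, boundary_single, map_add, hχ, hχ]
    have hfX : f ∈ X := ⟨Finsupp.mem_support_iff.1 hf, hfe⟩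
    have h2 : Γ.Reach X (Γ.src f) (Γ.tgt f) := Reach.step (f, true) hfX
    have : Γ.src f ∈ R ↔ Γ.tgt f ∈ R :=
      ⟨fun h => Reach.trans h h2, fun h => Reach.trans h h2.symm⟩
    by_cases h : Γ.src f ∈ R
    · rw [if_pos h, if_pos (this.1 h), CharTwo.add_self_eq_zero, smul_zero]
    · rw [if_neg h, if_neg fun h' => h (this.2 h'), add_zero, smul_zero]
  · intro h
    exact absurd (Finsupp.mem_support_iff.2 he) h

theorem IsPathIn.simple {X : Set Γ.E} {e : Γ.E} {p : List Γ.Step}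
    (h : Γ.IsPathIn X (Γ.tgt e) (Γ.src e) p) (he : e ∉ X) :
    Γ.IsWalkFrom (Γ.src e) (Γ.src e) ((e, true) :: p) ∧ Γ.IsSimpleClosed ((e, true) :: p) := by
  refine ⟨.cons rfl h.walk, by simp, ?_, ?_⟩
  · rw [walkEdges, List.map_cons]
    refine List.nodup_cons.2 ⟨?_, h.edges⟩
    intro hm
    obtain ⟨t, ht, hte⟩ := List.mem_map.1 hm
    have h2 := h.mem t ht
    rw [hte] at h2
    exact he h2
  · have := h.verts
    rw [List.nodup_append_comm] at this
    exact this

/-- `B` is a basis of the submodule `Z`. -/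
structure BasisOf {M : Type} [AddCommGroup M] [Module (ZMod 2) M] (Z : Submodule (ZMod 2) M)
    (B : Set M) : Prop where
  sub : ∀ c ∈ B, c ∈ Z
  indep : LinearIndependent (ZMod 2) (fun c : B => c.1)
  span : ∀ c ∈ Z, c ∈ Submodule.span (ZMod 2) B

theorem BasisOf.extend {M N ι : Type} [AddCommGroup M] [Module (ZMod 2) M]
    [AddCommGroup N] [Module (ZMod 2) N] {Z' Z : Submodule (ZMod 2) M} {B : Set M}
    (hB : BasisOf Z' B) (hZ : Z' ≤ Z) (f : M →ₗ[ZMod 2] N) (hf : ∀ c ∈ Z', f c = 0)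
    (hf' : ∀ c ∈ Z, f c = 0 → c ∈ Z') (a : ι → N) (ha : LinearIndependent (ZMod 2) a)
    (hs : ∀ c ∈ Z, f c ∈ Submodule.span (ZMod 2) (Set.range a)) (L : ι → M)
    (hL : ∀ i, L i ∈ Z) (hfL : ∀ i, f (L i) = a i) : BasisOf Z (B ∪ Set.range L) := by
  have hcomp : f ∘ L = a := funext hfL
  have hLi : LinearIndependent (ZMod 2) L := by
    apply LinearIndependent.of_comp f
    rw [hcomp]; exact ha
  refine ⟨?_, ?_, ?_⟩
  · rintro c (h | ⟨i, rfl⟩)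
    · exact hZ (hB.sub c h)
    · exact hL i
  · have h1 : LinearIndepOn (ZMod 2) id B := hB.indep
    have h2 : LinearIndepOn (ZMod 2) id (Set.range L) := hLi.linearIndepOn_id
    refine LinearIndepOn.id_union h1 h2 ?_
    rw [Submodule.disjoint_def]
    intro x hx hx'
    have hxz : f x = 0 := by
      apply hf
      exact Submodule.span_le.2 hB.sub hx
    obtain ⟨l, rfl⟩ := (Finsupp.mem_span_range_iff_exists_finsupp).1 hx'
    have : Finsupp.linearCombination (ZMod 2) a l = 0 := by
      rw [← hxz, Finsupp.linearCombination_apply, Finsupp.sum, Finsupp.sum, map_sum]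
      simp [hfL]
    rw [linearIndependent_iff.1 ha l this]
    simp
  · intro c hc
    obtain ⟨l, hl⟩ := (Finsupp.mem_span_range_iff_exists_finsupp).1 (hs c hc)
    set d := l.sum fun i r => r • L i with hd
    have hdZ : d ∈ Z := Submodule.sum_mem _ fun i _ => Z.smul_mem _ (hL i)
    have hdS : d ∈ Submodule.span (ZMod 2) (Set.range L) :=
      Submodule.sum_mem _ fun i _ => Submodule.smul_mem _ _ (Submodule.subset_span ⟨i, rfl⟩)
    have hfd : f d = f c := by
      rw [← hl, hd, Finsupp.sum, Finsupp.sum, map_sum]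
      simp [hfL]
    have h3 : c - d ∈ Z' := hf' _ (Z.sub_mem hc hdZ) (by rw [map_sub, hfd, sub_self])
    have h4 := hB.span _ h3
    rw [← sub_add_cancel c d]
    exact Submodule.add_mem _ (Submodule.span_mono Set.subset_union_left h4)
      (Submodule.span_mono Set.subset_union_right hdS)

/-- Binary cycles supported in `X`. -/
noncomputable def cyc (Γ : MGraph) (X : Set Γ.E) : Submodule (ZMod 2) (Γ.E →₀ ZMod 2) :=
  Γ.cycleSpace ⊓ Finsupp.supported (ZMod 2) (ZMod 2) X

theorem mem_cyc {X : Set Γ.E} {c : Γ.E →₀ ZMod 2} :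
    c ∈ Γ.cyc X ↔ c ∈ Γ.cycleSpace ∧ ∀ e, e ∉ X → c e = 0 := by
  rw [cyc, Submodule.mem_inf, Finsupp.mem_supported']

theorem exists_maximal (D X : Set Γ.E) (hDX : D ⊆ X) :
    ∃ F, D ⊆ F ∧ F ⊆ X ∧ (∀ c ∈ Γ.cyc F, c ∈ Γ.cyc D) ∧
      ∀ e ∈ X, e ∉ F → ∃ c ∈ Γ.cyc (insert e F), c e ≠ 0 := by
  let P : Set (Set Γ.E) := {F | D ⊆ F ∧ F ⊆ X ∧ ∀ c ∈ Γ.cyc F, c ∈ Γ.cyc D}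
  obtain ⟨F, hDF, hF⟩ := zorn_subset_nonempty P (by
    intro C hCP hC hne
    refine ⟨⋃₀ C, ⟨?_, ?_, ?_⟩, fun s hs => Set.subset_sUnion_of_mem hs⟩
    · obtain ⟨s, hs⟩ := hne
      exact (hCP hs).1.trans (Set.subset_sUnion_of_mem hs)
    · exact Set.sUnion_subset fun s hs => (hCP hs).2.1
    · intro c hc
      rw [mem_cyc] at hc
      have hfin : (c.support : Set Γ.E) ⊆ ⋃₀ C := by
        intro e he
        by_contra h
        exact (Finsupp.mem_support_iff.1 he) (hc.2 e h)
      obtain ⟨s, hs, hsub⟩ := DirectedOn.exists_mem_subset_of_finset_subset_biUnion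
        (f := fun s : Set Γ.E => s) hne (hC.directedOn) (by
          rw [← Set.sUnion_eq_biUnion]; exact hfin)
      refine (hCP hs).2.2 c (mem_cyc.2 ⟨hc.1, fun e he => ?_⟩)
      by_contra h
      exact he (hsub (Finsupp.mem_support_iff.2 h))) D ⟨subset_rfl, hDX, fun c hc => hc⟩
  refine ⟨F, hDF, hF.prop.2.1, hF.prop.2.2, ?_⟩
  intro e heX heF
  by_contra hno
  push Not at hno
  apply heF
  have hP : insert e F ∈ P := by
    refine ⟨hDF.trans (Set.subset_insert _ _), Set.insert_subset heX hF.prop.2.1, ?_⟩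
    intro c hc
    apply hF.prop.2.2
    have h0 := hno c hc
    rw [mem_cyc] at hc ⊢
    refine ⟨hc.1, fun f hf => ?_⟩
    by_cases hfe : f = e
    · rw [hfe, h0]
    · exact hc.2 f (by simp [hfe, hf])
  exact hF.le_of_ge hP (Set.subset_insert _ _) (Set.mem_insert _ _)

theorem fundamental (D X : Set Γ.E) (hDX : D ⊆ X) :
    ∃ (F : Set Γ.E) (p : Γ.E → List Γ.Step), D ⊆ F ∧ F ⊆ X ∧
      (∀ e ∈ X, e ∉ F → Γ.IsPathIn F (Γ.tgt e) (Γ.src e) (p e)) ∧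
      ∀ B, BasisOf (Γ.cyc D) B → BasisOf (Γ.cyc X)
        (B ∪ Set.range fun e : {e // e ∈ X ∧ e ∉ F} => Γ.chain ((e.1, true) :: p e.1)) := by
  obtain ⟨F, hDF, hFX, hF, hmax⟩ := exists_maximal D X hDX
  have hex : ∀ e, ∃ p, e ∈ X → e ∉ F → Γ.IsPathIn F (Γ.tgt e) (Γ.src e) p := by
    intro e
    by_cases h : e ∈ X ∧ e ∉ F
    · obtain ⟨c, hc, hce⟩ := hmax e h.1 h.2
      rw [mem_cyc] at hc
      obtain ⟨p, hp⟩ := exists_circle hc.1 e hce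
      refine ⟨p, fun _ _ => ⟨hp.walk, fun s hs => ?_, hp.verts, hp.edges⟩⟩
      have := hp.mem s hs
      by_contra hsF
      exact this.1 (hc.2 _ (by simp [this.2, hsF]))
    · exact ⟨[], fun h1 h2 => absurd ⟨h1, h2⟩ h⟩
  choose p hp using hex
  refine ⟨F, p, hDF, hFX, hp, fun B hB => ?_⟩
  have hinj : Function.Injective (Subtype.val : {e // e ∈ X ∧ e ∉ F} → Γ.E) :=
    Subtype.val_injective
  refine hB.extend ?_ (Finsupp.lcomapDomain (R := ZMod 2) (M := ZMod 2) Subtype.val hinj) ?_ ?_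
    (fun e => Finsupp.single e 1) ?_ ?_ _ ?_ ?_
  · intro c hc
    rw [mem_cyc] at hc ⊢
    exact ⟨hc.1, fun e he => hc.2 e fun h => he (hDX h)⟩
  · intro c hc
    rw [mem_cyc] at hc
    ext e
    exact hc.2 e.1 fun h => e.2.2 (hDF h)
  · intro c hc h0
    apply hF
    rw [mem_cyc] at hc ⊢
    refine ⟨hc.1, fun e he => ?_⟩
    by_cases hX : e ∈ X
    · exact DFunLike.congr_fun h0 (⟨e, hX, he⟩ : {e // e ∈ X ∧ e ∉ F})
    · exact hc.2 e hX
  · exact Finsupp.linearIndependent_single_one (ZMod 2) _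
  · intro c _
    have := Finsupp.mem_span_range_iff_exists_finsupp (R := ZMod 2)
      (v := fun e : {e // e ∈ X ∧ e ∉ F} => Finsupp.single e (1 : ZMod 2))
      (x := Finsupp.lcomapDomain (R := ZMod 2) (M := ZMod 2) Subtype.val hinj c)
    refine this.2 ⟨Finsupp.lcomapDomain (R := ZMod 2) (M := ZMod 2) Subtype.val hinj c, ?_⟩
    conv_rhs => rw [← Finsupp.sum_single (Finsupp.lcomapDomain (R := ZMod 2) (M := ZMod 2) Subtype.val hinj c)]
    simp
  · intro e
    have hpe := hp e.1 e.2.1 e.2.2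
    refine ⟨chain_mem (hpe.simple e.2.2).1, chain_mem_supported _ _ ?_⟩
    intro s hs
    rcases List.mem_cons.1 hs with rfl | hs
    · exact e.2.1
    · exact hFX (hpe.mem s hs)
  · intro e
    have hpe := hp e.1 e.2.1 e.2.2
    ext e'
    change Γ.chain ((e.1, true) :: p e.1) e'.1 = _
    rw [chain_cons, Finsupp.add_apply,
      chain_apply_zero (p e.1) e'.1 (fun s hs h => e'.2.2 (by rw [← h]; exact hpe.mem s hs)),
      add_zero]
    simp [Finsupp.single_apply, Subtype.ext_iff]

/-- A concrete model of `Δ` as a minor of `Γ`. -/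
structure Model (Γ Δ : MGraph) where
  S : Set Γ.E
  φ : Δ.E → Γ.E
  φ_inj : Function.Injective φ
  φ_not : ∀ e, φ e ∉ S
  ψ : Δ.V → Quot (Γ.contractRel S)
  ψ_inj : Function.Injective ψ
  flip : Δ.E → Bool
  start_eq : ∀ s : Δ.Step,
    Quot.mk _ (Γ.stepStart (φ s.1, xor s.2 (flip s.1))) = ψ (Δ.stepStart s)
  end_eq : ∀ s : Δ.Step,
    Quot.mk _ (Γ.stepEnd (φ s.1, xor s.2 (flip s.1))) = ψ (Δ.stepEnd s)

theorem IsMinor.model (h : Δ.IsMinor Γ) : Nonempty (Model Γ Δ) := by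
  obtain ⟨S, U, T, ⟨I⟩⟩ := h
  let φ : Δ.E → Γ.E := fun e => (I.eEquiv e).1.1
  let ψ : Δ.V → Quot (Γ.contractRel S) := fun v => (I.vEquiv v).1
  have key : ∀ e, ∃ b : Bool,
      (b = false ∧ Quot.mk (Γ.contractRel S) (Γ.src (φ e)) = ψ (Δ.src e) ∧
        Quot.mk (Γ.contractRel S) (Γ.tgt (φ e)) = ψ (Δ.tgt e)) ∨
      (b = true ∧ Quot.mk (Γ.contractRel S) (Γ.src (φ e)) = ψ (Δ.tgt e) ∧
        Quot.mk (Γ.contractRel S) (Γ.tgt (φ e)) = ψ (Δ.src e)) := by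
    intro e
    have := I.ends_eq e
    rw [Sym2.eq_iff] at this
    rcases this with ⟨h1, h2⟩ | ⟨h1, h2⟩
    · exact ⟨false, Or.inl ⟨rfl, congrArg Subtype.val h1, congrArg Subtype.val h2⟩⟩
    · exact ⟨true, Or.inr ⟨rfl, congrArg Subtype.val h1, congrArg Subtype.val h2⟩⟩
  choose fl hfl using key
  refine ⟨⟨S, φ, ?_, fun e => (I.eEquiv e).1.2, ψ, ?_, fl, ?_, ?_⟩⟩
  · intro e f h
    exact I.eEquiv.injective (Subtype.ext (Subtype.ext h))
  · intro e f h
    exact I.vEquiv.injective (Subtype.ext h)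
  · rintro ⟨e, b⟩
    rcases hfl e with ⟨h0, h1, h2⟩ | ⟨h0, h1, h2⟩ <;> cases b <;>
      simp [stepStart, h0, h1, h2]
  · rintro ⟨e, b⟩
    rcases hfl e with ⟨h0, h1, h2⟩ | ⟨h0, h1, h2⟩ <;> cases b <;>
      simp [stepEnd, h0, h1, h2]

theorem reach_of_quot_eq {S : Set Γ.E} {x y : Γ.V}
    (h : Quot.mk (Γ.contractRel S) x = Quot.mk (Γ.contractRel S) y) : Γ.Reach S x y := by
  have := Quot.eqvGen_exact h
  clear h
  induction this with
  | rel x y h =>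
    obtain ⟨e, he, rfl, rfl⟩ := h
    exact Reach.step (e, true) he
  | refl x => exact Reach.refl _ _
  | symm x y _ ih => exact ih.symm
  | trans x y z h1 h2 ih1 ih2 =>
    exact ih1.trans ih2

theorem quot_step {S : Set Γ.E} (s : Γ.Step) (hs : s.1 ∈ S) :
    Quot.mk (Γ.contractRel S) (Γ.stepStart s) = Quot.mk _ (Γ.stepEnd s) := by
  have : Quot.mk (Γ.contractRel S) (Γ.src s.1) = Quot.mk _ (Γ.tgt s.1) :=
    Quot.sound ⟨s.1, hs, rfl, rfl⟩
  rcases s with ⟨e, _ | _⟩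
  · exact this.symm
  · exact this

theorem quot_walk {S : Set Γ.E} {a b : Γ.V} {p : List Γ.Step} (h : Γ.IsWalkFrom a b p)
    (hp : ∀ s ∈ p, s.1 ∈ S) :
    Quot.mk (Γ.contractRel S) a = Quot.mk _ b ∧
      ∀ s ∈ p, Quot.mk (Γ.contractRel S) (Γ.stepStart s) = Quot.mk _ b := by
  induction h with
  | nil v => simp
  | @cons a b s l hs hw ih =>
    subst hs
    have h1 := ih fun t ht => hp t (by simp [ht])
    have h2 := (quot_step s (hp s (by simp))).trans h1.1
    refine ⟨h2, fun t ht => ?_⟩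
    rcases List.mem_cons.1 ht with rfl | ht
    · exact h2
    · exact h1.2 t ht

namespace Model

variable (M : Model Γ Δ)

/-- The step of `Γ` corresponding to a step of `Δ`. -/
def st (s : Δ.Step) : Γ.Step := (M.φ s.1, xor s.2 (M.flip s.1))

/-- The second list is a lift of the walk given by the first list. -/
inductive Lift : Γ.V → Γ.V → List Δ.Step → List Γ.Step → Prop
  | nil (x : Γ.V) : Lift x x [] []
  | cons {x y : Γ.V} {p : List Γ.Step} {s : Δ.Step} {l : List Δ.Step} {l' : List Γ.Step} :
      Γ.IsPathIn M.S x (Γ.stepStart (M.st s)) p → Lift (Γ.stepEnd (M.st s)) y l l' →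
      Lift x y (s :: l) (p ++ M.st s :: l')

variable {M}

theorem Lift.walk {x y : Γ.V} {l : List Δ.Step} {l' : List Γ.Step} (h : M.Lift x y l l') :
    Γ.IsWalkFrom x y l' := by
  induction h with
  | nil x => exact .nil _
  | cons hp _ ih => exact hp.walk.append (.cons rfl ih)

theorem Lift.ends {x y : Γ.V} {l : List Δ.Step} {l' : List Γ.Step} (h : M.Lift x y l l')
    (l₀ : List Δ.Step) (s : Δ.Step) (hl : l = l₀ ++ [s]) : y = Γ.stepEnd (M.st s) := by
  induction h generalizing l₀ with
  | nil x => simp at hl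
  | @cons x y p t l l' hp hL ih =>
    cases l₀ with
    | nil =>
      simp only [List.nil_append, List.cons.injEq] at hl
      obtain ⟨rfl, rfl⟩ := hl
      cases hL
      rfl
    | cons u l₀ =>
      simp only [List.cons_append, List.cons.injEq] at hl
      exact ih l₀ hl.2

theorem walk_ends {a b : Δ.V} {l : List Δ.Step} (h : Δ.IsWalkFrom a b l)
    (l₀ : List Δ.Step) (s : Δ.Step) (hl : l = l₀ ++ [s]) : b = Δ.stepEnd s := by
  induction h generalizing l₀ with
  | nil x => simp at hl
  | @cons a b t l ht hL ih =>
    cases l₀ with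
    | nil =>
      simp only [List.nil_append, List.cons.injEq] at hl
      obtain ⟨rfl, rfl⟩ := hl
      cases hL
      rfl
    | cons u l₀ =>
      simp only [List.cons_append, List.cons.injEq] at hl
      exact ih l₀ hl.2

theorem exists_lift {a b : Δ.V} {l : List Δ.Step} (h : Δ.IsWalkFrom a b l) (x : Γ.V)
    (hx : Quot.mk _ x = M.ψ a) : ∃ y l', M.Lift x y l l' := by
  induction h generalizing x with
  | nil v => exact ⟨x, [], .nil x⟩
  | @cons a b s l hs hw ih =>
    subst hs
    obtain ⟨y, l', hL⟩ := ih (Γ.stepEnd (M.st s)) (M.end_eq s)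
    obtain ⟨p, hp⟩ := (reach_of_quot_eq (hx.trans (M.start_eq s).symm)).exists_path
    exact ⟨y, _, .cons hp hL⟩

theorem exists_closed_lift {a : Δ.V} {l : List Δ.Step} (h : Δ.IsWalkFrom a a l) :
    ∃ x l', M.Lift x x l l' := by
  rcases List.eq_nil_or_concat l with rfl | ⟨l₀, s, hl⟩
  · obtain ⟨x, -⟩ := Quot.exists_rep (M.ψ a)
    exact ⟨x, [], .nil x⟩
  · rw [List.concat_eq_append] at hl
    have ha := walk_ends h l₀ s hl
    obtain ⟨y, l', hL⟩ := exists_lift (M := M) h (Γ.stepEnd (M.st s)) (by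
      rw [ha]; exact M.end_eq s)
    have := hL.ends l₀ s hl
    subst this
    exact ⟨_, _, hL⟩

theorem Lift.starts {x y : Γ.V} {l : List Δ.Step} {l' : List Γ.Step} (h : M.Lift x y l l') :
    ∀ s ∈ l', ∃ t ∈ l, Quot.mk _ (Γ.stepStart s) = M.ψ (Δ.stepStart t) := by
  induction h with
  | nil x => simp
  | @cons x y p t l l' hp hL ih =>
    intro s hs
    rcases List.mem_append.1 hs with hs | hs
    · exact ⟨t, by simp, ((quot_walk hp.walk hp.mem).2 s hs).trans (M.start_eq t)⟩
    · rcases List.mem_cons.1 hs with rfl | hs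
      · exact ⟨t, by simp, M.start_eq t⟩
      · obtain ⟨u, hu, h⟩ := ih s hs
        exact ⟨u, by simp [hu], h⟩

theorem Lift.edges {x y : Γ.V} {l : List Δ.Step} {l' : List Γ.Step} (h : M.Lift x y l l') :
    ∀ s ∈ l', s.1 ∈ M.S ∨ ∃ t ∈ l, s.1 = M.φ t.1 := by
  induction h with
  | nil x => simp
  | @cons x y p t l l' hp hL ih =>
    intro s hs
    rcases List.mem_append.1 hs with hs | hs
    · exact Or.inl (hp.mem s hs)
    · rcases List.mem_cons.1 hs with rfl | hs
      · exact Or.inr ⟨t, by simp, rfl⟩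
      · rcases ih s hs with h | ⟨u, hu, h⟩
        · exact Or.inl h
        · exact Or.inr ⟨u, by simp [hu], h⟩

theorem Lift.nodup_starts {x y : Γ.V} {l : List Δ.Step} {l' : List Γ.Step}
    (h : M.Lift x y l l') (hl : (l.map Δ.stepStart).Nodup) : (l'.map Γ.stepStart).Nodup := by
  induction h with
  | nil x => simp
  | @cons x y p t l l' hp hL ih =>
    rw [List.map_cons, List.nodup_cons] at hl
    rw [List.map_append, List.map_cons, ← List.singleton_append, ← List.append_assoc]
    refine List.nodup_append.2 ⟨hp.verts, ih hl.2, ?_⟩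
    have hcl : ∀ v ∈ p.map Γ.stepStart ++ [Γ.stepStart (M.st t)],
        Quot.mk _ v = M.ψ (Δ.stepStart t) := by
      intro v hv
      rcases List.mem_append.1 hv with hv | hv
      · obtain ⟨s, hs, rfl⟩ := List.mem_map.1 hv
        exact ((quot_walk hp.walk hp.mem).2 s hs).trans (M.start_eq t)
      · rw [List.mem_singleton] at hv
        rw [hv]
        exact M.start_eq t
    intro v hv w hw hvw
    subst hvw
    obtain ⟨s, hs, rfl⟩ := List.mem_map.1 hw
    obtain ⟨u, hu, h⟩ := hL.starts s hs
    have := M.ψ_inj (h.symm.trans (hcl _ hv))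
    exact hl.1 (this ▸ List.mem_map_of_mem hu)

theorem Lift.nodup_edges {x y : Γ.V} {l : List Δ.Step} {l' : List Γ.Step}
    (h : M.Lift x y l l') (hl : (l.map Δ.stepStart).Nodup) (hl' : (l.map Prod.fst).Nodup) :
    (l'.map Prod.fst).Nodup := by
  induction h with
  | nil x => simp
  | @cons x y p t l l' hp hL ih =>
    rw [List.map_cons, List.nodup_cons] at hl hl'
    rw [List.map_append, List.map_cons]
    refine List.nodup_append.2 ⟨hp.edges, List.nodup_cons.2 ⟨?_, ih hl.2 hl'.2⟩, ?_⟩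
    · intro hm
      obtain ⟨s, hs, hst⟩ := List.mem_map.1 hm
      rcases hL.edges s hs with h | ⟨u, hu, h⟩
      · rw [hst] at h
        exact M.φ_not _ h
      · have := M.φ_inj (hst.symm.trans h)
        exact hl'.1 (this ▸ List.mem_map_of_mem hu)
    · intro e he f hf hef
      subst hef
      obtain ⟨s, hs, rfl⟩ := List.mem_map.1 he
      have hsS := hp.mem s hs
      rcases List.mem_cons.1 hf with h | h
      · rw [h] at hsS
        exact M.φ_not _ hsS
      · obtain ⟨w, hw, hws⟩ := List.mem_map.1 h
        have h1 := ((quot_walk hp.walk hp.mem).2 s hs).trans (M.start_eq t)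
        obtain ⟨u, hu, h2⟩ := hL.starts w hw
        have h3 : Quot.mk (Γ.contractRel M.S) (Γ.stepStart w) = Quot.mk _ (Γ.stepStart s) := by
          rcases step_eq_or w s hws with h | h
          · rw [h]
          · rw [h, quot_step s hsS]
        have := M.ψ_inj (h2.symm.trans (h3.trans h1))
        exact hl.1 (this ▸ List.mem_map_of_mem hu)

theorem Lift.simple {x y : Γ.V} {l : List Δ.Step} {l' : List Γ.Step}
    (h : M.Lift x y l l') (hl : Δ.IsSimpleClosed l) : Γ.IsSimpleClosed l' := by
  refine ⟨?_, h.nodup_edges hl.2.2 hl.2.1, h.nodup_starts hl.2.2⟩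
  cases h with
  | nil => exact absurd rfl hl.1
  | cons => simp

theorem walkGain_one {G : Type} [Group G] (g : Γ.E → G) (p : List Γ.Step)
    (h : ∀ s ∈ p, g s.1 = 1) : Γ.walkGain g p = 1 := by
  apply List.prod_eq_one
  intro x hx
  obtain ⟨s, hs, rfl⟩ := List.mem_map.1 hx
  simp [stepGain, h s hs]

theorem Lift.gain {G : Type} [Group G] {g : Δ.E → G} {g' : Γ.E → G} {x y : Γ.V}
    {l : List Δ.Step} {l' : List Γ.Step} (h : M.Lift x y l l') (hS : ∀ e ∈ M.S, g' e = 1)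
    (hφ : ∀ s, Γ.stepGain g' (M.st s) = Δ.stepGain g s) :
    Γ.walkGain g' l' = Δ.walkGain g l := by
  induction h with
  | nil x => rfl
  | @cons x y p t l l' hp hL ih =>
    have h1 := walkGain_one g' p fun s hs => hS _ (hp.mem s hs)
    simp only [walkGain, List.map_append, List.map_cons, List.prod_append, List.prod_cons] at *
    rw [h1, hφ, ih, one_mul]

theorem Lift.chain {x y : Γ.V} {l : List Δ.Step} {l' : List Γ.Step} (h : M.Lift x y l l')
    (e : Δ.E) : Γ.chain l' (M.φ e) = Δ.chain l e := by
  induction h with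
  | nil x => rfl
  | @cons x y p t l l' hp hL ih =>
    rw [chain_append, chain_cons, chain_cons, Finsupp.add_apply, Finsupp.add_apply, ih,
      chain_apply_zero p (M.φ e) (fun s hs h => M.φ_not e (by rw [← h]; exact hp.mem s hs)),
      zero_add,
      Finsupp.add_apply]
    congr 1
    simp [st, Finsupp.single_apply, M.φ_inj.eq_iff]

theorem restrict_cycle (M : Model Γ Δ) (c : Γ.E →₀ ZMod 2)
    (hc : c ∈ Γ.cyc (M.S ∪ Set.range M.φ)) :
    Finsupp.lcomapDomain (R := ZMod 2) (M := ZMod 2) M.φ M.φ_inj c ∈ Δ.cycleSpace := by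
  let T₁ : (Γ.E →₀ ZMod 2) →ₗ[ZMod 2] (Quot (Γ.contractRel M.S) →₀ ZMod 2) :=
    (Finsupp.lmapDomain (ZMod 2) (ZMod 2) (Quot.mk (Γ.contractRel M.S))).comp Γ.boundary
  let T₂ : (Γ.E →₀ ZMod 2) →ₗ[ZMod 2] (Quot (Γ.contractRel M.S) →₀ ZMod 2) :=
    (Finsupp.lmapDomain (ZMod 2) (ZMod 2) M.ψ).comp
      (Δ.boundary.comp (Finsupp.lcomapDomain (R := ZMod 2) (M := ZMod 2) M.φ M.φ_inj))
  have hT : ∀ e ∈ M.S ∪ Set.range M.φ, T₁ (Finsupp.single e 1) = T₂ (Finsupp.single e 1) := by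
    rintro e (he | ⟨e, rfl⟩)
    · have h1 : Finsupp.lcomapDomain (R := ZMod 2) (M := ZMod 2) M.φ M.φ_inj (Finsupp.single e (1 : ZMod 2)) = 0 := by
        ext f
        change Finsupp.single e (1 : ZMod 2) (M.φ f) = 0
        refine Finsupp.single_eq_of_ne fun h => M.φ_not f (h ▸ he)
      simp only [T₁, T₂, LinearMap.comp_apply, h1, map_zero]
      rw [boundary_single, map_add, Finsupp.lmapDomain_apply, Finsupp.lmapDomain_apply,
        Finsupp.mapDomain_single, Finsupp.mapDomain_single,
        show Quot.mk (Γ.contractRel M.S) (Γ.src e) = Quot.mk _ (Γ.tgt e) from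
          quot_step (e, true) he, add_self_zero]
    · have h1 : Finsupp.lcomapDomain (R := ZMod 2) (M := ZMod 2) M.φ M.φ_inj (Finsupp.single (M.φ e) (1 : ZMod 2)) =
          Finsupp.single e 1 := by
        ext f
        change Finsupp.single (M.φ e) (1 : ZMod 2) (M.φ f) = _
        simp [Finsupp.single_apply, M.φ_inj.eq_iff]
      simp only [T₁, T₂, LinearMap.comp_apply, h1]
      have h2 := boundary_step (M.st (e, true))
      have h3 := boundary_step (Γ := Δ) (e, true)
      simp only [st] at h2
      rw [h2, h3, map_add, map_add]
      simp only [Finsupp.lmapDomain_apply, Finsupp.mapDomain_single]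
      have h4 := M.start_eq (e, true)
      have h5 := M.end_eq (e, true)
      simp only at h4 h5
      rw [h4, h5]
  have hsp : c ∈ Submodule.span (ZMod 2)
      ((fun e => Finsupp.single e (1 : ZMod 2)) '' (M.S ∪ Set.range M.φ)) := by
    rw [← Finsupp.supported_eq_span_single]
    exact hc.2
  have hEq : T₁ c = T₂ c := by
    refine LinearMap.eqOn_span (f := T₁) (g := T₂) ?_ hsp
    rintro _ ⟨e, he, rfl⟩
    exact hT e he
  have h0 : T₁ c = 0 := by
    simp only [T₁, LinearMap.comp_apply]
    rw [LinearMap.mem_ker.1 hc.1, map_zero]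
  rw [hEq] at h0
  rw [cycleSpace, LinearMap.mem_ker]
  exact Finsupp.mapDomain_injective M.ψ_inj (h0.trans Finsupp.mapDomain_zero.symm)

theorem walkGain_congr {G : Type} [Group G] {g g' : Γ.E → G} {p : List Γ.Step}
    (h : ∀ s ∈ p, g s.1 = g' s.1) : Γ.walkGain g p = Γ.walkGain g' p := by
  unfold walkGain
  congr 1
  refine List.map_congr_left fun s hs => ?_
  simp [stepGain, h s hs]

/-- The common core of both halves of the theorem; `P` says whether we insist on circles. -/
theorem main (M : Model Γ Δ) (P : Prop) {G : Type} [Group G] (g : Δ.E → G)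
    (B : Set (Δ.E →₀ ZMod 2)) (hB : Δ.IsCycleBasis B)
    (hBP : ∀ c ∈ B, ∃ l, (P → Δ.IsSimpleClosed l) ∧ Δ.IsCyclicOrientation c l ∧
      Δ.walkGain g l = 1) :
    ∃ (g' : Γ.E → G) (B' : Set (Γ.E →₀ ZMod 2)), Γ.IsCycleBasis B' ∧
      (∀ c ∈ B', ∃ l, (P → Γ.IsSimpleClosed l) ∧ Γ.IsCyclicOrientation c l ∧
        Γ.walkGain g' l = 1) ∧ (Γ.IsBalanced g' → Δ.IsBalanced g) := by
  obtain ⟨F₁, p₁, -, hF₁, hp₁, hb₁⟩ := fundamental (Γ := Γ) ∅ M.S (Set.empty_subset _)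
  obtain ⟨F₂, p₂, hF₂, -, hp₂, hb₂⟩ :=
    fundamental (Γ := Γ) (M.S ∪ Set.range M.φ) Set.univ (Set.subset_univ _)
  -- the gain function
  let g₀ : Γ.E → G := fun f =>
    if h : ∃ e, M.φ e = f then
      (if M.flip h.choose then (g h.choose)⁻¹ else g h.choose) else 1
  let g' : Γ.E → G := fun f => if f ∈ F₂ then g₀ f else (Γ.walkGain g₀ (p₂ f))⁻¹
  have hg₀φ : ∀ e, g₀ (M.φ e) = if M.flip e then (g e)⁻¹ else g e := by
    intro e
    have h : ∃ e', M.φ e' = M.φ e := ⟨e, rfl⟩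
    have h' : h.choose = e := M.φ_inj h.choose_spec
    simp only [g₀]
    rw [dif_pos h, h']
  have hg'F : ∀ f ∈ F₂, g' f = g₀ f := fun f hf => if_pos hf
  have hS : ∀ e ∈ M.S, g' e = 1 := by
    intro e he
    rw [hg'F e (hF₂ (Or.inl he))]
    simp only [g₀]
    rw [dif_neg]
    rintro ⟨e', rfl⟩
    exact M.φ_not _ he
  have hφ : ∀ s, Γ.stepGain g' (M.st s) = Δ.stepGain g s := by
    rintro ⟨e, b⟩
    have h1 : g' (M.φ e) = if M.flip e then (g e)⁻¹ else g e := by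
      rw [hg'F _ (hF₂ (Or.inr ⟨e, rfl⟩)), hg₀φ]
    simp only [stepGain, st, h1]
    cases b <;> cases M.flip e <;> simp
  -- lifts of the walks of `B`
  have hex : ∀ c : B, ∃ x l', Γ.IsWalkFrom x x l' ∧ (P → Γ.IsSimpleClosed l') ∧
      Γ.walkGain g' l' = 1 ∧ (∀ s ∈ l', s.1 ∈ M.S ∪ Set.range M.φ) ∧
      ∀ e, Γ.chain l' (M.φ e) = c.1 e := by
    rintro ⟨c, hc⟩
    obtain ⟨l, hP, hl, hgl⟩ := hBP c hc
    obtain ⟨a, ha⟩ := hl.1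
    obtain ⟨x, l', hL⟩ := exists_closed_lift (M := M) ha
    refine ⟨x, l', hL.walk, fun h => hL.simple (hP h), (hL.gain hS hφ).trans hgl, ?_, ?_⟩
    · intro s hs
      rcases hL.edges s hs with h | ⟨t, -, h⟩
      · exact Or.inl h
      · exact Or.inr ⟨t.1, h.symm⟩
    · intro e
      rw [hL.chain]
      exact (DFunLike.congr_fun (eq_chain hl) e).symm
  choose x l' hw hsimp hgain hsub hchain using hex
  -- the three stages of the basis
  have hB0 : BasisOf (Γ.cyc ∅) ∅ := by
    refine ⟨by simp, linearIndependent_empty_type, ?_⟩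
    intro c hc
    have : c = 0 := by
      ext e
      exact (mem_cyc.1 hc).2 e (by simp)
    rw [this]
    exact Submodule.zero_mem _
  have hB1 := hb₁ _ hB0
  have hB2 := hB1.extend (Z := Γ.cyc (M.S ∪ Set.range M.φ)) (by
      intro c hc
      rw [mem_cyc] at hc ⊢
      exact ⟨hc.1, fun e he => hc.2 e fun h => he (Or.inl h)⟩)
    (Finsupp.lcomapDomain (R := ZMod 2) (M := ZMod 2) M.φ M.φ_inj) (by
      intro c hc
      ext e
      exact (mem_cyc.1 hc).2 _ (M.φ_not e)) (by
      intro c hc h0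
      rw [mem_cyc] at hc ⊢
      refine ⟨hc.1, fun e he => ?_⟩
      by_cases h : e ∈ Set.range M.φ
      · obtain ⟨f, rfl⟩ := h
        exact DFunLike.congr_fun h0 f
      · exact hc.2 e (by simp only [Set.mem_union]; tauto))
    (fun c : B => c.1) hB.2.1 (by
      intro c hc
      rw [Subtype.range_coe]
      exact hB.2.2 _ (M.restrict_cycle c hc))
    (fun c => Γ.chain (l' c))
    (fun c => ⟨chain_mem (hw c), chain_mem_supported _ _ (hsub c)⟩)
    (fun c => by
      ext e
      exact hchain c e)
  have hB3 := hb₂ _ hB2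
  refine ⟨g', _, ⟨fun c hc => (hB3.sub c hc).1, hB3.indep, fun c hc => hB3.span c
    (mem_cyc.2 ⟨hc, fun e he => absurd (Set.mem_univ _) he⟩)⟩, ?_, ?_⟩
  · rintro c (((h | ⟨e, rfl⟩) | ⟨b, rfl⟩) | ⟨e, rfl⟩)
    · exact absurd h (by simp)
    · have hp := hp₁ e.1 e.2.1 e.2.2
      have hs := hp.simple e.2.2
      refine ⟨_, fun _ => hs.2, orientation_chain hs.1, walkGain_one _ _ ?_⟩
      intro s hs
      rcases List.mem_cons.1 hs with rfl | hs
      · exact hS _ e.2.1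
      · exact hS _ (hF₁ (hp.mem s hs))
    · exact ⟨l' b, hsimp b, orientation_chain (hw b), hgain b⟩
    · have hp := hp₂ e.1 e.2.1 e.2.2
      have hs := hp.simple e.2.2
      refine ⟨_, fun _ => hs.2, orientation_chain hs.1, ?_⟩
      have h1 : Γ.walkGain g' (p₂ e.1) = Γ.walkGain g₀ (p₂ e.1) :=
        walkGain_congr fun s hs => hg'F _ (hp.mem s hs)
      have h2 : g' e.1 = (Γ.walkGain g₀ (p₂ e.1))⁻¹ := if_neg e.2.2
      have h3 : Γ.walkGain g' ((e.1, true) :: p₂ e.1) = g' e.1 * Γ.walkGain g' (p₂ e.1) := by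
        simp [walkGain, stepGain]
      rw [h3, h1, h2, inv_mul_cancel]
  · intro hbal a l ha hl
    obtain ⟨x, m, hL⟩ := exists_closed_lift (M := M) ha
    rw [← hL.gain hS hφ]
    exact hbal x m hL.walk (hL.simple hl)

end Model

end MinorProof

end MGraph

/-- For any class of groups, the class of graphs for which the
Binary Cycle Test is valid is minor-closed, and likewise for the Circle Test. -/
theorem tests_minor_closed (𝒢 : GroupClass) :
    (∀ Γ Δ : MGraph, Δ.IsMinor Γ → Γ.BCTValidFor 𝒢 → Δ.BCTValidFor 𝒢) ∧
    (∀ Γ Δ : MGraph, Δ.IsMinor Γ → Γ.CircleTestValidFor 𝒢 → Δ.CircleTestValidFor 𝒢) := by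
  constructor
  · intro Γ Δ hm hΓ G instG hG g
    obtain ⟨M⟩ := hm.model
    rintro ⟨B, hB, hBP⟩
    obtain ⟨g', B', hB', hP, hbal⟩ := M.main False g B hB (by
      intro c hc
      obtain ⟨l, h1, h2⟩ := hBP c hc
      exact ⟨l, False.elim, h1, h2⟩)
    refine hbal (hΓ G hG g' ⟨B', hB', fun c hc => ?_⟩)
    obtain ⟨l, -, h1, h2⟩ := hP c hc
    exact ⟨l, h1, h2⟩
  · intro Γ Δ hm hΓ G instG hG g
    obtain ⟨M⟩ := hm.model
    rintro ⟨B, hB, hBP⟩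
    obtain ⟨g', B', hB', hP, hbal⟩ := M.main True g B hB (by
      intro c hc
      obtain ⟨l, h0, h1, h2⟩ := hBP c hc
      exact ⟨l, fun _ => h0, h1, h2⟩)
    refine hbal (hΓ G hG g' ⟨B', hB', fun c hc => ?_⟩)
    obtain ⟨l, h0, h1, h2⟩ := hP c hc
    exact ⟨l, h0 trivial, h1, h2⟩
end

section
/- Let G be a group and Γ a graph. If the Binary Cycle Test is valid for every gain graph (Γ, g, G) with gain group G, then for every edge set S ⊆ E(Γ) the Binary Cycle Test is valid for every gain graph (Γ∖S, g, G), where Γ∖S denotes Γ with the edges of S deleted. -/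
set_option maxHeartbeats 1000000
set_option synthInstance.maxHeartbeats 400000

attribute [local instance] Classical.propDecidable

noncomputable section
namespace BctAux

open MGraph

/-- The mod-2 chain of a walk. -/
def chain (Γ : MGraph) (l : List Γ.Step) : Γ.E →₀ ZMod 2 :=
  (l.map fun s => Finsupp.single s.1 1).sum

theorem chain_cons (Γ : MGraph) (s : Γ.Step) (l : List Γ.Step) :
    chain Γ (s :: l) = Finsupp.single s.1 1 + chain Γ l := by
  simp [chain]

theorem chain_apply (Γ : MGraph) (l : List Γ.Step) (e : Γ.E) :
    chain Γ l e = (countIn (Γ.walkEdges l) e : ZMod 2) := by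
  induction l with
  | nil => simp [chain, countIn, MGraph.walkEdges]
  | cons s l ih =>
    rw [chain_cons, Finsupp.add_apply, ih]
    by_cases h : s.1 = e
    · simp [countIn, MGraph.walkEdges, h]
    · simp [countIn, MGraph.walkEdges, h]

theorem orient_iff (Γ : MGraph) (c : Γ.E →₀ ZMod 2) (l : List Γ.Step) :
    Γ.IsCyclicOrientation c l ↔ (∃ v, Γ.IsWalkFrom v v l) ∧ c = chain Γ l := by
  unfold MGraph.IsCyclicOrientation
  refine and_congr_right fun _ => ⟨fun h => ?_, fun h e => ?_⟩
  · ext e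
    rw [h e, chain_apply]
  · rw [h, chain_apply]

theorem boundary_single (Γ : MGraph) (e : Γ.E) (a : ZMod 2) :
    Γ.boundary (Finsupp.single e a) =
      Finsupp.single (Γ.src e) a + Finsupp.single (Γ.tgt e) a := by
  simp [MGraph.boundary]

theorem chain_two {V : Type} (x : V →₀ ZMod 2) : x + x = 0 := by
  ext v
  exact CharTwo.add_self_eq_zero _

theorem boundary_chain (Γ : MGraph) {a b : Γ.V} {l : List Γ.Step}
    (h : Γ.IsWalkFrom a b l) :
    Γ.boundary (chain Γ l) = Finsupp.single a 1 + Finsupp.single b 1 := by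
  induction h with
  | nil v => rw [chain_two]; simp [chain]
  | @cons a b s l hs _ ih =>
    rw [chain_cons, map_add, ih, boundary_single, ← hs]
    have : Finsupp.single (Γ.src s.1) (1 : ZMod 2) + Finsupp.single (Γ.tgt s.1) 1 =
        Finsupp.single (Γ.stepStart s) 1 + Finsupp.single (Γ.stepEnd s) 1 := by
      unfold MGraph.stepStart MGraph.stepEnd
      by_cases hb : s.2 = true
      · simp [hb]
      · simp [hb, add_comm]
    rw [this, add_assoc, ← add_assoc (Finsupp.single (Γ.stepEnd s) 1), chain_two, zero_add]

theorem walk_snoc (Γ : MGraph) {a b : Γ.V} {l : List Γ.Step}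
    (h : Γ.IsWalkFrom a b l) (s : Γ.Step) (hs : Γ.stepStart s = b) :
    Γ.IsWalkFrom a (Γ.stepEnd s) (l ++ [s]) := by
  induction h with
  | nil v => exact .cons hs (.nil _)
  | cons h1 _ ih => exact .cons h1 (ih hs)

/-- Reachability using only edges in `A`. -/
def Reach (Γ : MGraph) (A : Set Γ.E) (x y : Γ.V) : Prop :=
  ∃ l, Γ.IsWalkFrom x y l ∧ ∀ s ∈ l, s.1 ∈ A

theorem reach_step (Γ : MGraph) (A : Set Γ.E) {x : Γ.V} (s : Γ.Step) (hA : s.1 ∈ A)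
    (h : Reach Γ A x (Γ.stepStart s)) : Reach Γ A x (Γ.stepEnd s) := by
  obtain ⟨l, hl, hl2⟩ := h
  refine ⟨l ++ [s], walk_snoc Γ hl s rfl, ?_⟩
  intro t ht
  rcases List.mem_append.1 ht with ht | ht
  · exact hl2 t ht
  · rw [List.mem_singleton.1 ht]; exact hA

theorem reach_edge (Γ : MGraph) (A : Set Γ.E) {x : Γ.V} (f : Γ.E) (hA : f ∈ A) :
    Reach Γ A x (Γ.src f) ↔ Reach Γ A x (Γ.tgt f) :=
  ⟨fun h => reach_step Γ A (x := x) (f, true) hA h,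
   fun h => reach_step Γ A (x := x) (f, false) hA h⟩

theorem reach_of_cycle (Γ : MGraph) (A : Set Γ.E) (e : Γ.E) (c : Γ.E →₀ ZMod 2)
    (hc : c ∈ Γ.cycleSpace) (hce : c e ≠ 0) (hA : ∀ f, f ∉ A → f ≠ e → c f = 0) :
    Reach Γ A (Γ.tgt e) (Γ.src e) := by
  by_contra hr
  let χ : Γ.V → ZMod 2 := fun v => if Reach Γ A (Γ.tgt e) v then 1 else 0
  have h0 : Finsupp.linearCombination (ZMod 2) χ (Γ.boundary c) = 0 := by
    rw [show Γ.boundary c = 0 from hc, map_zero]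
  have h1 : Finsupp.linearCombination (ZMod 2) χ (Γ.boundary c) =
      c.sum fun f a => a * (χ (Γ.src f) + χ (Γ.tgt f)) := by
    rw [MGraph.boundary, Finsupp.lsum_apply, Finsupp.sum, map_sum]
    refine Finset.sum_congr rfl fun f _ => ?_
    simp [mul_add]
  rw [h1, Finsupp.sum, Finset.sum_eq_single e] at h0
  · have h2 : χ (Γ.src e) = 0 := if_neg hr
    have h3 : χ (Γ.tgt e) = 1 := if_pos ⟨[], .nil _, by simp⟩
    rw [h2, h3] at h0
    simp at h0
    exact hce h0
  · intro f _ hfe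
    by_cases hf : f ∈ A
    · have : χ (Γ.src f) = χ (Γ.tgt f) := by
        simp only [χ, reach_edge Γ A f hf]
      rw [this, CharTwo.add_self_eq_zero, mul_zero]
    · rw [hA f hf hfe, zero_mul]
  · intro h
    exact absurd (Finsupp.notMem_support_iff.1 h) hce

/-- Adding the edges of `F` to `Γ ∖ S` creates no new cycle. -/
def Good (Γ : MGraph) (S F : Set Γ.E) : Prop :=
  ∀ c ∈ Γ.cycleSpace, (∀ e ∈ S, e ∉ F → c e = 0) → ∀ e ∈ S, c e = 0

theorem exists_good (Γ : MGraph) (S : Set Γ.E) :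
    ∃ F, Good Γ S F ∧ ∀ e ∈ S, e ∉ F → Reach Γ {f | f ∈ S → f ∈ F} (Γ.tgt e) (Γ.src e) := by
  obtain ⟨F, -, hF⟩ := zorn_subset_nonempty {F | Good Γ S F} (by
    intro C hC hch hne
    refine ⟨⋃₀ C, ?_, fun s hs => Set.subset_sUnion_of_mem hs⟩
    intro c hc hz
    have hfin : ((c.support : Set Γ.E) ∩ ⋃₀ C).Finite :=
      c.support.finite_toSet.subset Set.inter_subset_left
    obtain ⟨F0, hF0, hsub⟩ := DirectedOn.exists_mem_subset_of_finite_of_subset_sUnion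
      hne hch.directedOn hfin Set.inter_subset_right
    refine hC hF0 c hc fun e he heF => ?_
    by_contra hne0
    have hU : e ∈ ⋃₀ C := by
      by_contra hU
      exact hne0 (hz e he hU)
    exact heF (hsub ⟨by simpa using hne0, hU⟩)) ∅
    (fun c _ hz e he => hz e he (Set.notMem_empty e))
  refine ⟨F, hF.prop, fun e he heF => ?_⟩
  have hnot : ¬ Good Γ S (insert e F) := fun hg =>
    heF (hF.le_of_ge hg (Set.subset_insert e F) (Set.mem_insert e F))
  unfold Good at hnot
  push Not at hnot
  obtain ⟨c, hc, hz, f, hf, hcf⟩ := hnot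
  have key : ∀ f, f ∈ S → f ∉ F → f ≠ e → c f = 0 := fun f hf hfF hfe =>
    hz f hf (by simp [hfe, hfF])
  refine reach_of_cycle Γ _ e c hc ?_ ?_
  · intro h0
    refine hcf (hF.prop c hc (fun f hf hfF => ?_) f hf)
    by_cases hfe : f = e
    · rw [hfe, h0]
    · exact key f hf hfF hfe
  · intro f hf hfe
    simp only [Set.mem_ofPred_eq, Classical.not_imp] at hf
    exact key f hf.1 hf.2 hfe

section Del

variable (Γ : MGraph) (S : Set Γ.E)

/-- Inclusion of edges. -/
def inc (e : (Γ.deleteEdges S).E) : Γ.E := e.1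

/-- Inclusion of steps. -/
def incStep (s : (Γ.deleteEdges S).Step) : Γ.Step := (inc Γ S s.1, s.2)

theorem inc_inj : Function.Injective (inc Γ S) := Subtype.val_injective

theorem incStep_start (s : (Γ.deleteEdges S).Step) :
    Γ.stepStart (incStep Γ S s) = (Γ.deleteEdges S).stepStart s := rfl

theorem incStep_end (s : (Γ.deleteEdges S).Step) :
    Γ.stepEnd (incStep Γ S s) = (Γ.deleteEdges S).stepEnd s := rfl

theorem walk_inc {a b : (Γ.deleteEdges S).V} {l : List (Γ.deleteEdges S).Step}
    (h : (Γ.deleteEdges S).IsWalkFrom a b l) :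
    MGraph.IsWalkFrom Γ a b (l.map (incStep Γ S)) := by
  induction h with
  | nil v => exact .nil _
  | cons hs _ ih => exact .cons hs ih

theorem simple_inc {l : List (Γ.deleteEdges S).Step}
    (h : (Γ.deleteEdges S).IsSimpleClosed l) : Γ.IsSimpleClosed (l.map (incStep Γ S)) := by
  obtain ⟨h1, h2, h3⟩ := h
  refine ⟨by simpa using h1, ?_, ?_⟩
  · have : Γ.walkEdges (l.map (incStep Γ S)) =
        ((Γ.deleteEdges S).walkEdges l).map (inc Γ S) := by
      simp only [MGraph.walkEdges, List.map_map]; rfl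
    rw [this]
    exact h2.map (inc_inj Γ S)
  · rw [List.map_map]
    exact h3

theorem gain_inc {G : Type} [Group G] (g : Γ.E → G) (g' : (Γ.deleteEdges S).E → G)
    (h : ∀ e, g (inc Γ S e) = g' e) (l : List (Γ.deleteEdges S).Step) :
    Γ.walkGain g (l.map (incStep Γ S)) = (Γ.deleteEdges S).walkGain g' l := by
  unfold MGraph.walkGain
  rw [List.map_map]
  congr 1
  refine List.map_congr_left fun s _ => ?_
  simp only [Function.comp, MGraph.stepGain, incStep, h]

/-- Extension of chains by zero. -/
def ext0 : ((Γ.deleteEdges S).E →₀ ZMod 2) →ₗ[ZMod 2] (Γ.E →₀ ZMod 2) :=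
  Finsupp.lmapDomain (ZMod 2) (ZMod 2) (inc Γ S)

theorem ext0_chain (l : List (Γ.deleteEdges S).Step) :
    ext0 Γ S (chain _ l) = chain Γ (l.map (incStep Γ S)) := by
  induction l with
  | nil => simp [chain]
  | cons s l ih =>
    rw [chain_cons, List.map_cons, chain_cons, map_add, ih]
    congr 1
    simp [ext0, Finsupp.mapDomain_single, incStep]

theorem boundary_ext0 (c : (Γ.deleteEdges S).E →₀ ZMod 2) :
    Γ.boundary (ext0 Γ S c) = (Γ.deleteEdges S).boundary c := by
  induction c using Finsupp.induction_linear with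
  | zero => simp only [map_zero]; rfl
  | add f g hf hg => simp only [map_add, hf, hg]; rfl
  | single e a =>
    rw [boundary_single, ext0, Finsupp.lmapDomain_apply, Finsupp.mapDomain_single,
      boundary_single]
    rfl

theorem exists_ext0 (d : Γ.E →₀ ZMod 2) (hd : ∀ e ∈ S, d e = 0) :
    ∃ d', ext0 Γ S d' = d := by
  refine ⟨Finsupp.comapDomain (inc Γ S) d (inc_inj Γ S).injOn, ?_⟩
  refine Finsupp.mapDomain_comapDomain _ (inc_inj Γ S) _ ?_
  intro e he
  refine ⟨⟨e, fun heS => ?_⟩, rfl⟩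
  exact (Finsupp.mem_support_iff.1 he) (hd e heS)

end Del

theorem chain_zero (Γ : MGraph) (l : List Γ.Step) (e : Γ.E) (h : ∀ s ∈ l, s.1 ≠ e) :
    chain Γ l e = 0 := by
  induction l with
  | nil => simp [chain]
  | cons s l ih =>
    rw [chain_cons, Finsupp.add_apply, ih fun t ht => h t (List.mem_cons_of_mem _ ht)]
    simp [h s List.mem_cons_self]

theorem gain_congr (Γ : MGraph) {G : Type} [Group G] (g g' : Γ.E → G) (l : List Γ.Step)
    (h : ∀ s ∈ l, g s.1 = g' s.1) : Γ.walkGain g l = Γ.walkGain g' l := by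
  unfold MGraph.walkGain
  congr 1
  refine List.map_congr_left fun s hs => ?_
  simp only [MGraph.stepGain, h s hs]

theorem main (G : Type) [Group G] (Γ : MGraph)
    (h : ∀ g : Γ.E → G, Γ.BCTValid g) (S : Set Γ.E)
    (g : (Γ.deleteEdges S).E → G) : (Γ.deleteEdges S).BCTValid g := by
  rintro ⟨B, ⟨hB1, -, hB3⟩, hBp⟩
  obtain ⟨F, hF, hR⟩ := exists_good Γ S
  have hR' : ∀ e : Γ.E, ∃ l : List Γ.Step, e ∈ S → e ∉ F →
      Γ.IsWalkFrom (Γ.tgt e) (Γ.src e) l ∧ ∀ s ∈ l, s.1 ∈ S → s.1 ∈ F := by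
    intro e
    by_cases he : e ∈ S ∧ e ∉ F
    · obtain ⟨l, hl⟩ := hR e he.1 he.2
      exact ⟨l, fun _ _ => hl⟩
    · exact ⟨[], fun h1 h2 => absurd ⟨h1, h2⟩ he⟩
  choose w hw using hR'
  let g0 : Γ.E → G := fun e => if he : e ∉ S then g ⟨e, he⟩ else 1
  let g1 : Γ.E → G := fun e => if e ∈ S ∧ e ∉ F then (Γ.walkGain g0 (w e))⁻¹ else g0 e
  have hg1 : ∀ e, g1 (inc Γ S e) = g e := by
    intro e
    have he : inc Γ S e ∉ S := e.2
    simp only [g1, g0, he, false_and, if_false, not_false_eq_true, dif_pos]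
    rfl
  let cw : Γ.E → List Γ.Step := fun e => (e, true) :: w e
  have hcw : ∀ e ∈ S, e ∉ F → Γ.IsWalkFrom (Γ.src e) (Γ.src e) (cw e) := by
    intro e h1 h2
    refine .cons (by simp [MGraph.stepStart]) ?_
    simpa [MGraph.stepEnd] using (hw e h1 h2).1
  have hgain : ∀ e ∈ S, e ∉ F → Γ.walkGain g1 (cw e) = 1 := by
    intro e h1 h2
    have h3 : Γ.walkGain g1 (w e) = Γ.walkGain g0 (w e) := by
      refine gain_congr Γ _ _ _ fun s hs => ?_
      have := (hw e h1 h2).2 s hs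
      exact if_neg fun hh => hh.2 (this hh.1)
    have h4 : Γ.walkGain g1 (cw e) = g1 e * Γ.walkGain g1 (w e) := by
      simp [cw, MGraph.walkGain, MGraph.stepGain]
    rw [h4, h3]
    simp [g1, h1, h2]
  let T : Set (Γ.E →₀ ZMod 2) :=
    (ext0 Γ S '' B) ∪ {c | ∃ e ∈ S, e ∉ F ∧ c = chain Γ (cw e)}
  have hTcyc : ∀ c ∈ T, c ∈ Γ.cycleSpace := by
    rintro c (⟨b, hb, rfl⟩ | ⟨e, h1, h2, rfl⟩)
    · exact (boundary_ext0 Γ S b).trans (hB1 b hb)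
    · exact (boundary_chain Γ (hcw e h1 h2)).trans (chain_two _)
  have hTpass : Γ.PassesBCT g1 T := by
    rintro c (⟨b, hb, rfl⟩ | ⟨e, h1, h2, rfl⟩)
    · obtain ⟨l, hl, hl1⟩ := hBp b hb
      obtain ⟨⟨v, hv⟩, rfl⟩ := (orient_iff _ _ _).1 hl
      refine ⟨l.map (incStep Γ S), (orient_iff _ _ _).2 ⟨⟨v, walk_inc Γ S hv⟩, ?_⟩, ?_⟩
      · exact ext0_chain Γ S l
      · rw [gain_inc Γ S g1 g hg1, hl1]
    · exact ⟨cw e, (orient_iff _ _ _).2 ⟨⟨_, hcw e h1 h2⟩, rfl⟩, hgain e h1 h2⟩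
  have hTspan : ∀ c ∈ Γ.cycleSpace, c ∈ Submodule.span (ZMod 2) T := by
    intro c hc
    let p : Γ.E →₀ ZMod 2 :=
      ∑ e ∈ c.support.filter (fun e => e ∈ S ∧ e ∉ F), c e • chain Γ (cw e)
    have hp : p ∈ Submodule.span (ZMod 2) T := by
      refine Submodule.sum_mem _ fun e he => Submodule.smul_mem _ _ (Submodule.subset_span ?_)
      have := (Finset.mem_filter.1 he).2
      exact Or.inr ⟨e, this.1, this.2, rfl⟩
    have hpc : p ∈ Γ.cycleSpace := (Submodule.span_le.2 hTcyc) hp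
    have hd : c - p ∈ Γ.cycleSpace := Submodule.sub_mem _ hc hpc
    have hdz : ∀ e ∈ S, e ∉ F → (c - p) e = 0 := by
      intro e h1 h2
      have hpe : p e = c e := by
        simp only [p, Finsupp.finsetSum_apply, Finsupp.smul_apply, smul_eq_mul]
        rw [Finset.sum_eq_single e]
        · have hwe : chain Γ (w e) e = 0 := chain_zero Γ _ _ fun s hs hse =>
            h2 (hse ▸ (hw e h1 h2).2 s hs (hse ▸ h1))
          simp [cw, chain_cons, hwe]
        · intro f hf hfe
          have hf2 := (Finset.mem_filter.1 hf).2
          have : chain Γ (cw f) e = 0 := by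
            refine chain_zero Γ _ _ fun s hs hse => ?_
            rcases List.mem_cons.1 hs with rfl | hs
            · exact hfe hse
            · exact h2 (hse ▸ (hw f hf2.1 hf2.2).2 s hs (hse ▸ h1))
          rw [this, mul_zero]
        · intro he
          have : c e = 0 := by
            by_contra h0
            exact he (Finset.mem_filter.2 ⟨Finsupp.mem_support_iff.2 h0, h1, h2⟩)
          rw [this, zero_mul]
      rw [Finsupp.sub_apply, hpe, sub_self]
    obtain ⟨d', hd'⟩ := exists_ext0 Γ S (c - p) (hF _ hd hdz)
    have hd'c : d' ∈ (Γ.deleteEdges S).cycleSpace := by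
      refine (boundary_ext0 Γ S d').symm.trans ?_
      rw [hd']
      exact hd
    have hmem : c - p ∈ Submodule.span (ZMod 2) T := by
      rw [← hd']
      have := Submodule.mem_map_of_mem (f := ext0 Γ S) (hB3 d' hd'c)
      rw [Submodule.map_span] at this
      exact Submodule.span_mono Set.subset_union_left this
    simpa using Submodule.add_mem _ hmem hp
  obtain ⟨B', hB'T, hB's, hB'i⟩ := exists_linearIndependent (ZMod 2) T
  have hbal : Γ.IsBalanced g1 := h g1 ⟨B', ⟨fun c hc => hTcyc c (hB'T hc), hB'i,
    fun c hc => hB's ▸ hTspan c hc⟩, fun c hc => hTpass c (hB'T hc)⟩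
  intro v l hl hs
  rw [← gain_inc Γ S g1 g hg1]
  exact hbal v _ (walk_inc Γ S hl) (simple_inc Γ S hs)

end BctAux
end

/-- If the Binary Cycle Test is valid for every gain graph on `Γ`
with gain group `G`, then it is valid for every gain graph on `Γ ∖ S` with gain
group `G`. -/
theorem bct_valid_deletion (G : Type) [Group G] (Γ : MGraph)
    (h : ∀ g : Γ.E → G, Γ.BCTValid g) (S : Set Γ.E) :
    ∀ g : (Γ.deleteEdges S).E → G, (Γ.deleteEdges S).BCTValid g := by
  exact fun g => BctAux.main G Γ h S g
end
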